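/- Let n ≥ 1 and let G be a discrete subgroup of PU(1,n). Then G acts discontinuously on its equicontinuity region Eq(G): for every compact set K ⊆ Eq(G), the set {g ∈ G : g(K) ∩ K ≠ ∅} is finite. -/

import Mathlib

open Filter Topology Matrix

noncomputable section

abbrev Vec (n : ℕ) := Fin (n + 1) → ℂ
abbrev Mat (n : ℕ) := Matrix (Fin (n + 1)) (Fin (n + 1)) ℂ
abbrev Pn (n : ℕ) := Projectivization ℂ (Vec n)

instance (n : ℕ) : TopologicalSpace (Pn n) :=
  inferInstanceAs (TopologicalSpace (Quotient (projectivizationSetoid ℂ (Vec n))))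

def herm (n : ℕ) (u v : Vec n) : ℂ :=
  -(u 0 * (starRingEnd ℂ) (v 0)) + ∑ j : Fin n, u j.succ * (starRingEnd ℂ) (v j.succ)

def Hball (n : ℕ) : Set (Pn n) :=
  {p | ∃ v : Vec n, ∃ hv : v ≠ 0, p = Projectivization.mk ℂ v hv ∧ (herm n v v).re < 0}

def Hbdry (n : ℕ) : Set (Pn n) :=
  {p | ∃ v : Vec n, ∃ hv : v ≠ 0, p = Projectivization.mk ℂ v hv ∧ herm n v v = 0}

abbrev GLn (n : ℕ) := Matrix.GeneralLinearGroup (Fin (n + 1)) ℂ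
abbrev PGLn (n : ℕ) := GLn n ⧸ Subgroup.center (GLn n)

lemma glInj {n : ℕ} (A : GLn n) : Function.Injective (Matrix.mulVecLin (A : Mat n)) := by
  intro x y h
  simp only [Matrix.mulVecLin_apply] at h
  have h2 : ((A⁻¹ : GLn n) : Mat n) *ᵥ ((A : Mat n) *ᵥ x)
      = ((A⁻¹ : GLn n) : Mat n) *ᵥ ((A : Mat n) *ᵥ y) := by rw [h]
  rwa [Matrix.mulVec_mulVec, Matrix.mulVec_mulVec, Units.inv_mul, Matrix.one_mulVec,
    Matrix.one_mulVec] at h2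

def actGL {n : ℕ} (A : GLn n) : Pn n → Pn n :=
  Projectivization.map (Matrix.mulVecLin (A : Mat n)) (glInj A)

def act {n : ℕ} (g : PGLn n) : Pn n → Pn n := actGL (Quotient.out g)

-- part 2 --

/-- The subset `U(1,n)` of `GL(n+1,ℂ)`: matrices preserving the Hermitian form. -/
def unitaryGL (n : ℕ) : Set (GLn n) :=
  {A | ∀ u v : Vec n, herm n ((A : Mat n) *ᵥ u) ((A : Mat n) *ᵥ v) = herm n u v}

/-- `PU(1,n)`, the image of `U(1,n)` in `PGL(n+1,ℂ)`. -/
def PUset (n : ℕ) : Set (PGLn n) := (QuotientGroup.mk : GLn n → PGLn n) '' unitaryGL n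

/-- The center of the ball `𝐇ⁿ_ℂ`, namely the image of `(1,0,…,0)`. -/
def basePt (n : ℕ) : Pn n :=
  Projectivization.mk ℂ (Pi.single 0 1) (by
    intro h
    have := congrFun h 0
    simp [Pi.single_eq_same] at this)

lemma basePt_mem_Hball (n : ℕ) : basePt n ∈ Hball n := by
  refine ⟨Pi.single 0 1, _, rfl, ?_⟩
  have : herm n (Pi.single 0 1) (Pi.single 0 1) = -1 := by
    simp [herm, Pi.single_eq_same, Pi.single_eq_of_ne (Fin.succ_ne_zero _)]
  rw [this]
  norm_num

/-- The set of accumulation points of the orbit `G • x` in `ℙⁿ_ℂ`: limits of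
`g_m • x` along sequences of pairwise distinct elements of `G`. -/
def accPts {n : ℕ} (G : Subgroup (PGLn n)) (x : Pn n) : Set (Pn n) :=
  {z | ∃ g : ℕ → G, Function.Injective g ∧
    Tendsto (fun m => act (g m : PGLn n) x) atTop (𝓝 z)}

/-- The Chen–Greenberg limit set of `G`. -/
def LambdaCG {n : ℕ} (G : Subgroup (PGLn n)) : Set (Pn n) := accPts G (basePt n)

/-- Uniform convergence on `K` of a sequence of self-maps of `ℙⁿ_ℂ` to `F`, expressed
via open neighborhoods of the diagonal.  Since `ℙⁿ_ℂ` is compact Hausdorff, this is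
equivalent to uniform convergence on `K` with respect to any metric inducing its
topology. -/
def UnifConvOn {n : ℕ} (f : ℕ → Pn n → Pn n) (F : Pn n → Pn n) (K : Set (Pn n)) : Prop :=
  ∀ W : Set (Pn n × Pn n), IsOpen W → (∀ y, (y, y) ∈ W) →
    ∀ᶠ m in atTop, ∀ x ∈ K, (F x, f m x) ∈ W

/-- Uniform convergence on all compact subsets of `S`. -/
def UnifConvOnCompacts {n : ℕ} (f : ℕ → Pn n → Pn n) (F : Pn n → Pn n)
    (S : Set (Pn n)) : Prop :=
  ∀ K ⊆ S, IsCompact K → UnifConvOn f F K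

/-- The equicontinuity region of a subgroup `G ≤ PGL(n+1,ℂ)`: points having an open
neighborhood `U` on which every sequence in `G` has a subsequence converging uniformly
on compact subsets of `U`. -/
def eqRegion {n : ℕ} (G : Subgroup (PGLn n)) : Set (Pn n) :=
  {z | ∃ U : Set (Pn n), IsOpen U ∧ z ∈ U ∧
    ∀ g : ℕ → G, ∃ φ : ℕ → ℕ, StrictMono φ ∧ ∃ F : Pn n → Pn n,
      UnifConvOnCompacts (fun m => act (g (φ m) : PGLn n)) F U}

/-- The equicontinuity region of the family of maps `{f m : m ∈ ℕ}`. -/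
def eqRegionFam {n : ℕ} (f : ℕ → Pn n → Pn n) : Set (Pn n) :=
  {z | ∃ U : Set (Pn n), IsOpen U ∧ z ∈ U ∧
    ∀ s : ℕ → ℕ, ∃ φ : ℕ → ℕ, StrictMono φ ∧ ∃ F : Pn n → Pn n,
      UnifConvOnCompacts (fun k => f (s (φ k))) F U}

/-- The projectivization of a linear subspace `W ⊆ ℂ^{n+1}`, as a subset of `ℙⁿ_ℂ`. -/
def projSet {n : ℕ} (W : Submodule ℂ (Vec n)) : Set (Pn n) := {p | p.rep ∈ W}

/-- A complex projective hyperplane: the projectivization of an `n`-dimensional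
subspace of `ℂ^{n+1}`. -/
def IsProjHyperplane {n : ℕ} (S : Set (Pn n)) : Prop :=
  ∃ W : Submodule ℂ (Vec n), Module.finrank ℂ W = n ∧ S = projSet W

/-- A complex projective line: the projectivization of a `2`-dimensional subspace. -/
def IsProjLine {n : ℕ} (S : Set (Pn n)) : Prop :=
  ∃ W : Submodule ℂ (Vec n), Module.finrank ℂ W = 2 ∧ S = projSet W

/-- The kernel in `ℙⁿ_ℂ` of the quasi-projective map induced by the nonzero matrix `M`. -/
def qKer {n : ℕ} (M : Mat n) : Set (Pn n) := projSet (LinearMap.ker (Matrix.mulVecLin M))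

/-- The image in `ℙⁿ_ℂ` of the quasi-projective map induced by the nonzero matrix `M`. -/
def qIm {n : ℕ} (M : Mat n) : Set (Pn n) := projSet (LinearMap.range (Matrix.mulVecLin M))

/-- The quasi-projective map `ℙⁿ_ℂ ∖ Ker(M) → ℙⁿ_ℂ` induced by the nonzero matrix `M`
(extended to all of `ℙⁿ_ℂ` by the identity on `Ker(M)`, where it is irrelevant). -/
def qMap {n : ℕ} (M : Mat n) : Pn n → Pn n := fun p =>
  if h : M *ᵥ p.rep ≠ 0 then Projectivization.mk ℂ (M *ᵥ p.rep) h else p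

/-- Convergence of a sequence of transformations of `ℙⁿ_ℂ` to the quasi-projective map
induced by `M`, in the sense of quasi-projective transformations: uniform convergence
on compact subsets of `ℙⁿ_ℂ ∖ Ker(M)`. -/
def QPConv {n : ℕ} (f : ℕ → Pn n → Pn n) (M : Mat n) : Prop :=
  UnifConvOnCompacts f (qMap M) (qKer M)ᶜ

/-- The special linear group `SL(n+1,ℂ)`. -/
abbrev SLn (n : ℕ) := Matrix.SpecialLinearGroup (Fin (n + 1)) ℂ

/-- The projective special linear group `PSL(n+1,ℂ) = SL(n+1,ℂ)/center`. -/
abbrev PSLn (n : ℕ) := SLn n ⧸ Subgroup.center (SLn n)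

/-- The projective transformation induced by an element of `SL(n+1,ℂ)`. -/
def actSL {n : ℕ} (A : SLn n) : Pn n → Pn n := actGL (Matrix.SpecialLinearGroup.toGL A)

/-- The projective transformation induced by an element of `PSL(n+1,ℂ)` (via an
arbitrary representative; all representatives induce the same transformation). -/
def actPSL {n : ℕ} (g : PSLn n) : Pn n → Pn n := actSL (Quotient.out g)

/-- The projective hyperplane tangent to `∂𝐇ⁿ_ℂ` at `p`: the projectivization of the
Hermitian orthogonal complement of a lift of `p`. -/
def tangentAt {n : ℕ} (p : Pn n) : Set (Pn n) := {q | herm n q.rep p.rep = 0}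

end

/-- The matrix of the Hermitian form of signature `(1,n)`. -/
def hermMat (n : ℕ) : Mat n := Matrix.diagonal (Fin.cons (-1) fun _ => 1)

lemma herm_eq_dotProduct {n : ℕ} (u v : Vec n) : herm n u v = star v ⬝ᵥ (hermMat n *ᵥ u) := by
  simp only [herm, hermMat, dotProduct, Matrix.mulVec_diagonal, Fin.sum_univ_succ, Fin.cons_zero,
    Fin.cons_succ, Pi.star_apply, RCLike.star_def]
  congr 1
  · ring
  · exact Finset.sum_congr rfl fun j _ => by ring

lemma hermMat_mul_self (n : ℕ) : hermMat n * hermMat n = 1 := by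
  rw [hermMat, Matrix.diagonal_mul_diagonal, ← Matrix.diagonal_one]
  congr 1
  ext i
  refine Fin.cases ?_ (fun j => ?_) i <;> simp

lemma conjTranspose_mul_hermMat_mul {n : ℕ} {A : GLn n} (hA : A ∈ unitaryGL n) :
    (A : Mat n)ᴴ * hermMat n * (A : Mat n) = hermMat n := by
  have h : ∀ u v : Vec n, star v ⬝ᵥ (((A : Mat n)ᴴ * hermMat n * (A : Mat n)) *ᵥ u)
      = star v ⬝ᵥ (hermMat n *ᵥ u) := by
    intro u v
    rw [← herm_eq_dotProduct, ← hA u v, herm_eq_dotProduct, Matrix.star_mulVec,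
      ← Matrix.dotProduct_mulVec, Matrix.mulVec_mulVec, Matrix.mulVec_mulVec, Matrix.mul_assoc]
  ext i j
  have := h (Pi.single j 1) (Pi.single i 1)
  simpa [← Pi.single_star] using this

lemma coe_inv_of_mem_unitaryGL {n : ℕ} {A : GLn n} (hA : A ∈ unitaryGL n) :
    ((A⁻¹ : GLn n) : Mat n) = hermMat n * (A : Mat n)ᴴ * hermMat n := by
  have h : (hermMat n * (A : Mat n)ᴴ * hermMat n) * (A : Mat n) = 1 := by
    rw [Matrix.mul_assoc, Matrix.mul_assoc, ← Matrix.mul_assoc _ (hermMat n) (A : Mat n),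
      conjTranspose_mul_hermMat_mul hA, hermMat_mul_self]
  exact Units.inv_eq_of_mul_eq_one_left h

lemma inv_mem_unitaryGL {n : ℕ} {A : GLn n} (hA : A ∈ unitaryGL n) : A⁻¹ ∈ unitaryGL n := by
  intro u v
  rw [← hA]
  simp [Matrix.mulVec_mulVec]

lemma herm_smul_smul {n : ℕ} (a b : ℂ) (u v : Vec n) :
    herm n (a • u) (b • v) = a * starRingEnd ℂ b * herm n u v := by
  simp only [herm, Pi.smul_apply, smul_eq_mul, map_mul, mul_add, Finset.mul_sum]
  congr 1
  · ring
  · exact Finset.sum_congr rfl fun j _ => by ring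

lemma continuous_herm_self (n : ℕ) : Continuous fun v : Vec n => herm n v v := by
  unfold herm
  exact (((continuous_apply 0).mul (Complex.continuous_conj.comp (continuous_apply 0))).neg).add
    (continuous_finsetSum _ fun j _ =>
      (continuous_apply _).mul (Complex.continuous_conj.comp (continuous_apply _)))

/-- A null vector with vanishing zeroth coordinate vanishes. -/
lemma eq_zero_of_herm_self_eq_zero {n : ℕ} {v : Vec n} (h : herm n v v = 0) (h0 : v 0 = 0) :
    v = 0 := by
  have h1 : ∑ j : Fin n, ‖v j.succ‖ ^ 2 = 0 := by
    simp only [herm, h0, zero_mul, neg_zero, zero_add, Complex.mul_conj'] at h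
    exact_mod_cast h
  rw [Finset.sum_eq_zero_iff_of_nonneg fun _ _ => by positivity] at h1
  ext i
  refine Fin.cases h0 (fun j => ?_) i
  simpa using h1 j (Finset.mem_univ j)

lemma exists_norm_eq_one_mk_eq {n : ℕ} (x : Pn n) :
    ∃ (v : Vec n) (hv : v ≠ 0), ‖v‖ = 1 ∧ Projectivization.mk ℂ v hv = x := by
  have hr : ‖x.rep‖ ≠ 0 := norm_ne_zero_iff.mpr x.rep_nonzero
  have hr' : ((‖x.rep‖⁻¹ : ℝ) : ℂ) ≠ 0 := Complex.ofReal_ne_zero.mpr (inv_ne_zero hr)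
  refine ⟨((‖x.rep‖⁻¹ : ℝ) : ℂ) • x.rep, smul_ne_zero hr' x.rep_nonzero, ?_, ?_⟩
  · rw [norm_smul, Complex.norm_real, norm_inv, norm_norm, inv_mul_cancel₀ hr]
  · conv_rhs => rw [← x.mk_rep]
    rw [Projectivization.mk_eq_mk_iff']
    exact ⟨_, rfl⟩

lemma act_mk {n : ℕ} {g : PGLn n} {A : GLn n} (h : (QuotientGroup.mk A : PGLn n) = g)
    {v w : Vec n} (hv : v ≠ 0) (hw : w ≠ 0) {a : ℂ} (ha : a ≠ 0)
    (hvw : w = a • (A : Mat n) *ᵥ v) :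
    act g (Projectivization.mk ℂ v hv) = Projectivization.mk ℂ w hw := by
  have hc : A⁻¹ * Quotient.out g ∈ Subgroup.center (GLn n) := by
    rw [← QuotientGroup.eq, h]
    exact (QuotientGroup.out_eq' g).symm
  obtain ⟨c, hc⟩ := Matrix.GeneralLinearGroup.mem_center_iff_val_mem_range_scalar.mp hc
  have ho : ((Quotient.out g : GLn n) : Mat n) = c • (A : Mat n) := by
    have : Quotient.out g = A * (A⁻¹ * Quotient.out g) := by group
    rw [this, Units.val_mul, ← hc]
    ext i j
    simp [Matrix.scalar_apply, mul_comm]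
  unfold act actGL
  rw [Projectivization.map_mk, Projectivization.mk_eq_mk_iff']
  refine ⟨c * a⁻¹, ?_⟩
  rw [hvw, smul_smul, mul_assoc, inv_mul_cancel₀ ha, mul_one, Matrix.mulVecLin_apply, ho,
    Matrix.smul_mulVec]

lemma tendsto_mulVec {n : ℕ} {ι : Type*} {l : Filter ι} {B : ι → Mat n} {v : ι → Vec n} {M : Mat n}
    {u : Vec n} (hB : Tendsto B l (𝓝 M)) (hv : Tendsto v l (𝓝 u)) :
    Tendsto (fun i => B i *ᵥ v i) l (𝓝 (M *ᵥ u)) := by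
  refine tendsto_pi_nhds.mpr fun i => ?_
  simp only [Matrix.mulVec, dotProduct]
  refine tendsto_finsetSum _ fun j _ => Tendsto.mul ?_ ?_
  · exact tendsto_pi_nhds.mp (tendsto_pi_nhds.mp hB i) j
  · exact tendsto_pi_nhds.mp hv j

/-- The function `[v] ↦ ‖M v‖ / ‖v‖` on projective space. -/
noncomputable def normRatio {n : ℕ} (M : Mat n) (p : Pn n) : ℝ := ‖M *ᵥ p.rep‖ / ‖p.rep‖

lemma normRatio_mk {n : ℕ} (M : Mat n) {v : Vec n} (hv : v ≠ 0) :
    normRatio M (Projectivization.mk ℂ v hv) = ‖M *ᵥ v‖ / ‖v‖ := by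
  obtain ⟨a, ha⟩ := Projectivization.exists_smul_eq_mk_rep ℂ v hv
  have : ‖(a : ℂ)‖ ≠ 0 := norm_ne_zero_iff.mpr a.ne_zero
  rw [normRatio, ← ha, Units.smul_def, Matrix.mulVec_smul, norm_smul, norm_smul,
    mul_div_mul_left _ _ this]

lemma continuous_normRatio {n : ℕ} (M : Mat n) : Continuous (normRatio M) := by
  refine (isQuotientMap_quotient_mk' (s := projectivizationSetoid ℂ (Vec n))).continuous_iff.mpr ?_
  have : (normRatio M) ∘ (Quotient.mk (projectivizationSetoid ℂ (Vec n)))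
      = fun v : {v : Vec n // v ≠ 0} => ‖M *ᵥ (v : Vec n)‖ / ‖(v : Vec n)‖ := by
    ext v
    exact normRatio_mk M v.2
  change Continuous ((normRatio M) ∘ (Quotient.mk (projectivizationSetoid ℂ (Vec n))))
  rw [this]
  refine Continuous.div ?_ ?_ ?_
  · exact ((continuous_const (y := M)).matrix_mulVec continuous_subtype_val).norm
  · exact continuous_subtype_val.norm
  · exact fun v => norm_ne_zero_iff.mpr v.2

lemma continuous_mk_comp {n : ℕ} {X : Type*} [TopologicalSpace X] {f : X → Vec n}
    (hf : Continuous f) (h : ∀ x, f x ≠ 0) :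
    Continuous fun x => (Projectivization.mk ℂ (f x) (h x) : Pn n) :=
  (continuous_quotient_mk' (s := projectivizationSetoid ℂ (Vec n))).comp (hf.subtype_mk h)

/-- Uniform convergence on the image of a compact set gives uniform convergence of the
compositions with a continuous real-valued function. -/
lemma UnifConvOnCompacts.tendstoUniformlyOn_comp {n : ℕ} {f : ℕ → Pn n → Pn n} {F : Pn n → Pn n}
    {U : Set (Pn n)} (h : UnifConvOnCompacts f F U) {τ : Pn n → ℝ} (hτ : Continuous τ)
    {X : Type*} [TopologicalSpace X] {l : X → Pn n} (hl : Continuous l) {C : Set X}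
    (hC : IsCompact C) (hCU : l '' C ⊆ U) :
    TendstoUniformlyOn (fun m t => τ (f m (l t))) (fun t => τ (F (l t))) atTop C := by
  rw [Metric.tendstoUniformlyOn_iff]
  intro ε hε
  have := h _ hCU (hC.image hl) {q | dist (τ q.1) (τ q.2) < ε}
    (isOpen_lt (by fun_prop) continuous_const) (by simpa using hε)
  filter_upwards [this] with m hm t ht
  exact hm _ (Set.mem_image_of_mem _ ht)

lemma herm_self_eq_zero_of_tendsto {n : ℕ} {A : ℕ → GLn n} (hA : ∀ m, A m ∈ unitaryGL n)
    {c : ℕ → ℂ} (hc : Tendsto c atTop (𝓝 0)) {M : Mat n}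
    (hM : Tendsto (fun m => c m • (A m : Mat n)) atTop (𝓝 M)) (v : Vec n) :
    herm n (M *ᵥ v) (M *ᵥ v) = 0 := by
  have h1 : Tendsto (fun m => (c m • (A m : Mat n)) *ᵥ v) atTop (𝓝 (M *ᵥ v)) :=
    tendsto_mulVec hM tendsto_const_nhds
  have h2 := ((continuous_herm_self n).tendsto _).comp h1
  have h3 : Tendsto (fun m => c m * starRingEnd ℂ (c m) * herm n v v) atTop (𝓝 0) := by
    simpa using (hc.mul ((Complex.continuous_conj.tendsto 0).comp hc)).mul_const (herm n v v)
  refine tendsto_nhds_unique h2 (h3.congr fun m => ?_)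
  simp only [Function.comp_apply]
  rw [Matrix.smul_mulVec, herm_smul_smul, hA]

/-- If rescaled lifts of a sequence in `G` converge to `M`, with scaling factors tending to zero,
then the equicontinuity region of `G` does not meet the kernel of `M`. -/
lemma mulVec_rep_ne_zero_of_mem_eqRegion {n : ℕ} {G : Subgroup (PGLn n)} {g : ℕ → G}
    {A : ℕ → GLn n} (hA : ∀ m, A m ∈ unitaryGL n)
    (hg : ∀ m, (QuotientGroup.mk (A m) : PGLn n) = g m)
    {c : ℕ → ℂ} (hc0 : ∀ m, c m ≠ 0) (hc : Tendsto c atTop (𝓝 0)) {M : Mat n} (hM0 : M ≠ 0)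
    (hM : Tendsto (fun m => c m • (A m : Mat n)) atTop (𝓝 M))
    {p : Pn n} (hp : p ∈ eqRegion G) : M *ᵥ p.rep ≠ 0 := by
  intro hz
  obtain ⟨U, hU, hpU, hconv⟩ := hp
  obtain ⟨φ, hφ, F, hF⟩ := hconv g
  set z := p.rep
  have hz0 : z ≠ 0 := p.rep_nonzero
  obtain ⟨w, hw⟩ : ∃ w, M *ᵥ w ≠ 0 := by
    by_contra! h
    exact hM0 (Matrix.ext_of_mulVec_single fun i => by rw [h, Matrix.zero_mulVec])
  set q := M *ᵥ w with hq
  have hq0 : q 0 ≠ 0 := fun h =>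
    hw (eq_zero_of_herm_self_eq_zero (herm_self_eq_zero_of_tendsto hA hc hM w) h)
  have hMl : ∀ t : ℂ, M *ᵥ (z + t • w) = t • q := fun t => by
    rw [Matrix.mulVec_add, Matrix.mulVec_smul, hz, zero_add]
  have hl0 : ∀ t : ℂ, z + t • w ≠ 0 := by
    intro t ht
    have h := hMl t
    rw [ht, Matrix.mulVec_zero] at h
    rcases smul_eq_zero.mp h.symm with h | h
    · simp [h, hz0] at ht
    · exact hw h
  set B : ℕ → Mat n := fun m => c (φ m) • (A (φ m) : Mat n) with hB
  have hBM : Tendsto B atTop (𝓝 M) := hM.comp hφ.tendsto_atTop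
  have hBv : ∀ v, Tendsto (fun m => B m *ᵥ v) atTop (𝓝 (M *ᵥ v)) := fun v =>
    tendsto_mulVec hBM tendsto_const_nhds
  have hB0 : ∀ m v, v ≠ 0 → B m *ᵥ v ≠ 0 := by
    intro m v hv h
    rw [hB, Matrix.smul_mulVec, smul_eq_zero_iff_right (hc0 _)] at h
    exact hv (glInj (A (φ m)) (by simpa using h))
  set l : ℂ → Pn n := fun t => Projectivization.mk ℂ (z + t • w) (hl0 t) with hl
  have hlc : Continuous l := continuous_mk_comp (by fun_prop) hl0
  set E : Mat n := Matrix.single 0 0 1 with hE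
  have hEn : ∀ v : Vec n, ‖E *ᵥ v‖ = ‖v 0‖ := fun v => by
    rw [hE, Matrix.single_mulVec, one_mul]
    exact Pi.norm_single (G := fun _ => ℂ) (v 0)
  have hact : ∀ m t, normRatio E (act (g (φ m) : PGLn n) (l t))
      = ‖(B m *ᵥ (z + t • w)) 0‖ / ‖B m *ᵥ (z + t • w)‖ := fun m t => by
    rw [hl, act_mk (hg (φ m)) (hl0 t) (hB0 m _ (hl0 t)) (hc0 (φ m)) (by
      rw [hB, Matrix.smul_mulVec]), normRatio_mk, hEn]
  have hl_zero : l 0 = p := by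
    simp only [hl, zero_smul, add_zero]
    exact p.mk_rep
  obtain ⟨ε, hε, hεU⟩ := Metric.nhds_basis_closedBall.mem_iff.mp
    ((hU.preimage hlc).mem_nhds (show l 0 ∈ U from hl_zero ▸ hpU))
  have hunif := hF.tendstoUniformlyOn_comp (continuous_normRatio E) hlc
    (isCompact_closedBall (0 : ℂ) ε) (Set.image_subset_iff.mpr hεU)
  have hball : Metric.closedBall (0 : ℂ) ε ∈ 𝓝 (0 : ℂ) := Metric.closedBall_mem_nhds _ hε
  have hcont : ContinuousAt (fun t => normRatio E (F (l t))) 0 := by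
    refine (hunif.continuousOn (Frequently.of_forall fun m => ?_)).continuousAt hball
    simp only [hact]
    refine Continuous.continuousOn (Continuous.div ?_ ?_ fun t =>
      norm_ne_zero_iff.mpr (hB0 m _ (hl0 t)))
    · exact ((continuous_apply 0).comp
        ((continuous_const (y := B m)).matrix_mulVec (by fun_prop))).norm
    · exact ((continuous_const (y := B m)).matrix_mulVec (by fun_prop)).norm
  have hlim : ∀ t ∈ Metric.closedBall (0 : ℂ) ε, t ≠ 0 →
      normRatio E (F (l t)) = ‖q 0‖ / ‖q‖ := by
    intro t ht ht0
    have h1 := hunif.tendsto_at ht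
    simp only [hact] at h1
    have h2 := hBv (z + t • w)
    rw [hMl] at h2
    have h3 := (((continuous_apply 0).tendsto _).comp h2).norm.div h2.norm
      (norm_ne_zero_iff.mpr (smul_ne_zero ht0 hw))
    rw [tendsto_nhds_unique h1 h3, Pi.smul_apply, smul_eq_mul, norm_mul, norm_smul,
      mul_div_mul_left _ _ (norm_ne_zero_iff.mpr ht0)]
  have hzero : normRatio E (F (l 0)) = ‖q 0‖ / ‖q‖ := by
    refine tendsto_nhds_unique (hcont.tendsto.mono_left (nhdsWithin_le_nhds (s := {0}ᶜ)))
      (tendsto_const_nhds.congr' ?_)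
    filter_upwards [self_mem_nhdsWithin, mem_nhdsWithin_of_mem_nhds hball] with t ht hb
    exact (hlim t hb ht).symm
  have hBw : Tendsto (fun m => (B m *ᵥ w) 0) atTop (𝓝 (q 0)) :=
    ((continuous_apply 0).tendsto _).comp (hBv w)
  have hBz : Tendsto (fun m => (B m *ᵥ z) 0) atTop (𝓝 0) := by
    have := ((continuous_apply 0).tendsto _).comp (hBv z)
    rwa [hz] at this
  set s : ℕ → ℂ := fun m => -(B m *ᵥ z) 0 / (B m *ᵥ w) 0 with hs
  have hs0 : Tendsto s atTop (𝓝 0) := by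
    have := hBz.neg.div hBw hq0
    rwa [neg_zero, zero_div] at this
  have hball' : 𝓝[Metric.closedBall (0 : ℂ) ε] (0 : ℂ) = 𝓝 0 := nhdsWithin_eq_nhds.mpr hball
  have hlims := hunif.tendsto_comp hcont.continuousWithinAt (hball'.symm ▸ hs0)
  have hev : ∀ᶠ m in atTop, (0 : ℝ) = normRatio E (act (g (φ m) : PGLn n) (l (s m))) := by
    filter_upwards [hBw.eventually_ne hq0] with m hm
    rw [hact, Matrix.mulVec_add, Matrix.mulVec_smul, Pi.add_apply, Pi.smul_apply, smul_eq_mul, hs,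
      div_mul_cancel₀ _ hm, add_neg_cancel, norm_zero, zero_div]
  have := tendsto_nhds_unique hlims (tendsto_const_nhds.congr' hev)
  rw [hzero] at this
  exact (div_ne_zero (norm_ne_zero_iff.mpr hq0) (norm_ne_zero_iff.mpr hw)) this

section MatrixNorm

attribute [local instance] Matrix.normedAddCommGroup Matrix.normedSpace

/-- Unitary lifts of pairwise distinct elements of a discrete group have norms tending to
infinity. -/
lemma tendsto_norm_lift_atTop {n : ℕ} {G : Subgroup (PGLn n)} (hdisc : DiscreteTopology ↥G)
    {g : ℕ → G} (hinj : Function.Injective g) {A : ℕ → GLn n} (hA : ∀ m, A m ∈ unitaryGL n)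
    (hg : ∀ m, (QuotientGroup.mk (A m) : PGLn n) = g m) :
    Tendsto (fun m => ‖(A m : Mat n)‖) atTop atTop := by
  by_contra hcon
  rw [tendsto_atTop] at hcon
  push Not at hcon
  obtain ⟨b, hb⟩ := hcon
  obtain ⟨M, -, φ, hφ, hlim⟩ := tendsto_subseq_of_frequently_bounded
    (Metric.isBounded_closedBall (x := (0 : Mat n)) (r := b))
    (x := fun m => (A m : Mat n)) (hb.mono fun m hm => by simpa using hm.le)
  have hinv : Tendsto (fun m => (((A (φ m))⁻¹ : GLn n) : Mat n)) atTop
      (𝓝 (hermMat n * Mᴴ * hermMat n)) := by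
    simp only [fun m => coe_inv_of_mem_unitaryGL (hA (φ m))]
    exact (((continuous_const.matrix_mul continuous_id.matrix_conjTranspose).matrix_mul
      continuous_const).tendsto M).comp hlim
  have h1 : M * (hermMat n * Mᴴ * hermMat n) = 1 :=
    tendsto_nhds_unique (((continuous_fst.matrix_mul continuous_snd).tendsto _).comp
      (hlim.prodMk_nhds hinv)) (tendsto_const_nhds.congr fun m => by simp)
  have h2 : (hermMat n * Mᴴ * hermMat n) * M = 1 :=
    tendsto_nhds_unique (((continuous_fst.matrix_mul continuous_snd).tendsto _).comp
      (hinv.prodMk_nhds hlim)) (tendsto_const_nhds.congr fun m => by simp)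
  let L : GLn n := ⟨M, hermMat n * Mᴴ * hermMat n, h1, h2⟩
  have hL : Tendsto (fun m => A (φ m)) atTop (𝓝 L) := by
    rw [Units.isEmbedding_embedProduct.tendsto_nhds_iff]
    exact hlim.prodMk_nhds ((MulOpposite.continuous_op.tendsto _).comp hinv)
  have hgL : Tendsto (fun m => (g (φ m) : PGLn n)) atTop (𝓝 (QuotientGroup.mk L)) := by
    simp only [← hg]
    exact (QuotientGroup.continuous_mk.tendsto L).comp hL
  have hquot : Tendsto (fun m => g (φ m) * (g (φ (m + 1)))⁻¹) atTop (𝓝 (1 : G)) := by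
    rw [tendsto_subtype_rng]
    simpa using hgL.mul (hgL.comp (tendsto_add_atTop_nat 1)).inv
  rw [nhds_discrete, tendsto_pure] at hquot
  obtain ⟨m, hm⟩ := hquot.exists
  have := hφ.injective (hinj (mul_inv_eq_one.mp hm))
  omega

/-- A sequence of pairwise distinct elements of a discrete subgroup of `PU(1,n)` has a subsequence
with unitary lifts which converge, after rescaling, to a nonzero matrix. -/
lemma exists_tendsto_smul_lift {n : ℕ} {G : Subgroup (PGLn n)}
    (hPU : (G : Set (PGLn n)) ⊆ PUset n) (hdisc : DiscreteTopology ↥G)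
    {g : ℕ → G} (hinj : Function.Injective g) :
    ∃ φ : ℕ → ℕ, StrictMono φ ∧ ∃ (A : ℕ → GLn n) (c : ℕ → ℂ) (M : Mat n),
      (∀ m, A m ∈ unitaryGL n) ∧ (∀ m, (QuotientGroup.mk (A m) : PGLn n) = g (φ m)) ∧
      (∀ m, c m ≠ 0) ∧ (∀ m, starRingEnd ℂ (c m) = c m) ∧ Tendsto c atTop (𝓝 0) ∧ M ≠ 0 ∧
      Tendsto (fun m => c m • (A m : Mat n)) atTop (𝓝 M) := by
  choose A hA hg using fun m => hPU (g m).2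
  have hnorm := tendsto_norm_lift_atTop hdisc hinj hA hg
  have hpos : ∀ m, ‖(A m : Mat n)‖ ≠ 0 := fun m => norm_ne_zero_iff.mpr (A m).ne_zero
  obtain ⟨M, hM, φ, hφ, hlim⟩ := (isCompact_sphere (0 : Mat n) 1).tendsto_subseq
    (x := fun m => ((‖(A m : Mat n)‖⁻¹ : ℝ) : ℂ) • (A m : Mat n)) fun m => by
      rw [mem_sphere_zero_iff_norm, norm_smul, Complex.norm_real, norm_inv, norm_norm,
        inv_mul_cancel₀ (hpos m)]
  refine ⟨φ, hφ, A ∘ φ, fun m => ((‖(A (φ m) : Mat n)‖⁻¹ : ℝ) : ℂ), M, fun m => hA _,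
    fun m => hg _, fun m => ?_, fun m => Complex.conj_ofReal _, ?_, ?_, hlim⟩
  · exact Complex.ofReal_ne_zero.mpr (inv_ne_zero (hpos _))
  · exact_mod_cast (Complex.continuous_ofReal.tendsto 0).comp
      (tendsto_inv_atTop_zero.comp (hnorm.comp hφ.tendsto_atTop))
  · rintro rfl
    simp at hM

end MatrixNorm

/-- On a compact set avoiding the kernel of `M`, the ratio `‖M v‖ / ‖v‖` is bounded below. -/
lemma exists_pos_mul_norm_le_norm_mulVec {n : ℕ} {M : Mat n} {K : Set (Pn n)} (hK : IsCompact K)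
    (h : ∀ p ∈ K, M *ᵥ p.rep ≠ 0) :
    ∃ δ > 0, ∀ (v : Vec n) (hv : v ≠ 0), Projectivization.mk ℂ v hv ∈ K →
      δ * ‖v‖ ≤ ‖M *ᵥ v‖ := by
  obtain ⟨δ, hδ, hle⟩ := hK.exists_forall_le' (f := normRatio M) (a := 0)
    (continuous_normRatio M).continuousOn fun p hp =>
      div_pos (norm_pos_iff.mpr (h p hp)) (norm_pos_iff.mpr p.rep_nonzero)
  refine ⟨δ, hδ, fun v hv hvK => ?_⟩
  have := hle _ hvK
  rwa [normRatio_mk, le_div_iff₀ (norm_pos_iff.mpr hv)] at this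

/-- Rescaled lifts of a sequence in `PU(1,n)` and of the sequence of inverses converge to matrices
whose product vanishes. -/
lemma exists_tendsto_smul_inv {n : ℕ} {A : ℕ → GLn n} (hA : ∀ m, A m ∈ unitaryGL n)
    {c : ℕ → ℂ} (hcr : ∀ m, starRingEnd ℂ (c m) = c m) (hc : Tendsto c atTop (𝓝 0)) {M : Mat n}
    (hM0 : M ≠ 0) (hM : Tendsto (fun m => c m • (A m : Mat n)) atTop (𝓝 M)) :
    ∃ N : Mat n, N ≠ 0 ∧ N * M = 0 ∧
      Tendsto (fun m => c m • (((A m)⁻¹ : GLn n) : Mat n)) atTop (𝓝 N) := by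
  have hN := (((continuous_const (y := hermMat n)).matrix_mul
    continuous_id.matrix_conjTranspose).matrix_mul
    (continuous_const (y := hermMat n))).tendsto M |>.comp hM
  set N : Mat n := hermMat n * Mᴴ * hermMat n with hNdef
  replace hN : Tendsto (fun m => c m • (((A m)⁻¹ : GLn n) : Mat n)) atTop (𝓝 N) :=
    hN.congr fun m => by
      simp [coe_inv_of_mem_unitaryGL (hA m), Matrix.conjTranspose_smul, hcr]
  have hN0 : N ≠ 0 := by
    intro h
    have h' : hermMat n * N * hermMat n = Mᴴ := by
      rw [hNdef, ← Matrix.mul_assoc, ← Matrix.mul_assoc, hermMat_mul_self, Matrix.one_mul,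
        Matrix.mul_assoc, hermMat_mul_self, Matrix.mul_one]
    rw [h, Matrix.mul_zero, Matrix.zero_mul] at h'
    exact hM0 (Matrix.conjTranspose_eq_zero.mp h'.symm)
  have hNM : N * M = 0 :=
    tendsto_nhds_unique (((continuous_fst.matrix_mul continuous_snd).tendsto _).comp
      (hN.prodMk_nhds hM)) (by
        have : Tendsto (fun m => (c m * c m) • (1 : Mat n)) atTop (𝓝 0) := by
          simpa using (hc.mul hc).smul_const (1 : Mat n)
        refine this.congr fun m => ?_
        simp [smul_smul])
  exact ⟨N, hN0, hNM, hN⟩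

/-- A sequence in `G` whose rescaled lifts converge cannot move points of a compact subset of the
equicontinuity region into that subset. -/
lemma not_forall_image_inter_nonempty {n : ℕ} {G : Subgroup (PGLn n)} {g : ℕ → G}
    {A : ℕ → GLn n} (hA : ∀ m, A m ∈ unitaryGL n)
    (hg : ∀ m, (QuotientGroup.mk (A m) : PGLn n) = g m)
    {c : ℕ → ℂ} (hc0 : ∀ m, c m ≠ 0) (hcr : ∀ m, starRingEnd ℂ (c m) = c m)
    (hc : Tendsto c atTop (𝓝 0)) {M : Mat n} (hM0 : M ≠ 0)
    (hM : Tendsto (fun m => c m • (A m : Mat n)) atTop (𝓝 M))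
    {K : Set (Pn n)} (hKE : K ⊆ eqRegion G) (hK : IsCompact K) :
    ¬ ∀ m, ((act (g m : PGLn n) '' K) ∩ K).Nonempty := by
  intro hne
  obtain ⟨N, hN0, hNM, hN⟩ := exists_tendsto_smul_inv hA hcr hc hM0 hM
  obtain ⟨δ, hδ, hδM⟩ := exists_pos_mul_norm_le_norm_mulVec hK fun p hp =>
    mulVec_rep_ne_zero_of_mem_eqRegion hA hg hc0 hc hM0 hM (hKE hp)
  obtain ⟨η, hη, hηN⟩ := exists_pos_mul_norm_le_norm_mulVec hK fun p hp =>
    mulVec_rep_ne_zero_of_mem_eqRegion (g := fun m => (g m)⁻¹) (A := fun m => (A m)⁻¹)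
      (fun m => inv_mem_unitaryGL (hA m)) (fun m => by simp [hg]) hc0 hc hN0 hN (hKE hp)
  have hpts : ∀ m, ∃ v : Vec n, ‖v‖ = 1 ∧ δ ≤ ‖M *ᵥ v‖ ∧
      η * ‖(c m • (A m : Mat n)) *ᵥ v‖ ≤ ‖N *ᵥ ((c m • (A m : Mat n)) *ᵥ v)‖ := by
    intro m
    obtain ⟨-, ⟨x, hx, rfl⟩, hy⟩ := hne m
    obtain ⟨v, hv0, hv1, hxv⟩ := exists_norm_eq_one_mk_eq x
    have hAv0 : (c m • (A m : Mat n)) *ᵥ v ≠ 0 := by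
      rw [Matrix.smul_mulVec]
      exact smul_ne_zero (hc0 m) fun h => hv0 (glInj (A m) (by simpa using h))
    refine ⟨v, hv1, by simpa [hv1] using hδM v hv0 (hxv ▸ hx), hηN _ hAv0 ?_⟩
    rw [← act_mk (hg m) hv0 hAv0 (hc0 m) (Matrix.smul_mulVec _ _ _), hxv]
    exact hy
  choose v hv1 hvM hvN using hpts
  obtain ⟨u, -, ψ, hψ, hu⟩ := (isCompact_sphere (0 : Vec n) 1).tendsto_subseq (x := v)
    fun m => by simpa using hv1 m
  have h1 : δ ≤ ‖M *ᵥ u‖ :=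
    ge_of_tendsto' (tendsto_mulVec tendsto_const_nhds hu).norm fun m => hvM (ψ m)
  have hlim : Tendsto (fun m => (c (ψ m) • (A (ψ m) : Mat n)) *ᵥ v (ψ m)) atTop (𝓝 (M *ᵥ u)) :=
    tendsto_mulVec (hM.comp hψ.tendsto_atTop) hu
  have h2 : η * ‖M *ᵥ u‖ ≤ ‖N *ᵥ (M *ᵥ u)‖ :=
    le_of_tendsto_of_tendsto' (hlim.norm.const_mul η)
      (tendsto_mulVec tendsto_const_nhds hlim).norm fun m => hvN (ψ m)
  rw [Matrix.mulVec_mulVec, hNM, Matrix.zero_mulVec, norm_zero] at h2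
  nlinarith

/-- A discrete subgroup `G` of `PU(1,n)` acts discontinuously on its
equicontinuity region: for every compact `K ⊆ Eq(G)`, only finitely many `g ∈ G`
satisfy `g(K) ∩ K ≠ ∅`. -/
theorem acts_discontinuously_on_eqRegion
    (n : ℕ) (hn : 1 ≤ n) (G : Subgroup (PGLn n))
    (hPU : (G : Set (PGLn n)) ⊆ PUset n) (hdisc : DiscreteTopology ↥G) :
    ∀ K ⊆ eqRegion G, IsCompact K →
      {g : G | ((act (g : PGLn n) '' K) ∩ K).Nonempty}.Finite := by
  intro K hKE hK
  by_contra hinf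
  replace hinf : {g : G | ((act (g : PGLn n) '' K) ∩ K).Nonempty}.Infinite := hinf
  let e := hinf.natEmbedding
  obtain ⟨φ, -, A, c, M, hA, hg, hc0, hcr, hc, hM0, hM⟩ := exists_tendsto_smul_lift hPU hdisc
    (g := fun m => (e m : G)) (Subtype.val_injective.comp e.injective)
  exact not_forall_image_inter_nonempty hA hg hc0 hcr hc hM0 hM hKE hK fun m => (e (φ m)).2
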